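/- arXiv:1703.01891 — 2 statements merged into one kernel-verified Lean document; each statement's English description precedes it below -/
import Mathlib

section
/- Let β be an uncountable regular cardinal, let n ≥ 1, let Γ_1, …, Γ_n be sets, and let f : Γ_1 × ⋯ × Γ_n → {1, …, n} be a function such that for every index j and every line L in direction j, the set {b ∈ L : f(b) = j} is finite. Suppose T_1 ⊆ Γ_1, …, T_n ⊆ Γ_n are subsets each of cardinality at least exp_+(β, n). Then for every index i there exist a natural number K and subsets Γ'_1 ⊆ T_1, …, Γ'_n ⊆ T_n, each of cardinality at least β, such that for every choice of coordinates a_j ∈ Γ'_j for j ≠ i, the set {x ∈ Γ'_i : f(a_1, …, a_{i-1}, x, a_{i+1}, …, a_n) = i} has at most K elements. -/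
open Cardinal

/-- `exp_+(β, 0) = β`, `exp_+(β, n+1) = (2 ^ (exp_+(β,n))⁺)⁺`, where `⁺` is the
successor cardinal. -/
noncomputable def expPlus (β : Cardinal) : ℕ → Cardinal
  | 0 => β
  | n + 1 => Order.succ (2 ^ Order.succ (expPlus β n))

lemma le_expPlus_succ (β : Cardinal) (n : ℕ) : expPlus β n ≤ expPlus β (n + 1) :=
  (Order.le_succ _).trans ((cantor _).le.trans (Order.le_succ _))

lemma expPlus_monotone (β : Cardinal) : Monotone (expPlus β) :=
  monotone_nat_of_le_succ (le_expPlus_succ β)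

lemma le_expPlus (β : Cardinal) (n : ℕ) : β ≤ expPlus β n :=
  expPlus_monotone β (Nat.zero_le n)

/-- A function to a type of cardinality at most `2 ^ κ` on a set of cardinality more than `2 ^ κ`
is constant on a subset of cardinality more than `2 ^ κ`. -/
lemma exists_large_fiber.{u} {α δ : Type u} {κ : Cardinal.{u}} (hκ : ℵ₀ ≤ κ) (T : Set α)
    (hT : Order.succ (2 ^ κ) ≤ #T) (g : α → δ) (hδ : #δ ≤ 2 ^ κ) :
    ∃ d, Order.succ (2 ^ κ) ≤ #{x | x ∈ T ∧ g x = d} := by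
  have h2 : ℵ₀ ≤ (2 : Cardinal) ^ κ := hκ.trans (cantor κ).le
  have hreg := isRegular_succ h2
  obtain ⟨d, hd⟩ := infinite_pigeonhole_card (fun x : T => g x) _ hT hreg.aleph0_le
    (by rw [hreg.cof_ord]; exact Order.lt_succ_of_le hδ)
  refine ⟨d, hd.trans ?_⟩
  exact mk_le_of_injective (f := fun x => ⟨x.1.1, x.1.2, x.2⟩) fun x y h => by
    simpa [Subtype.ext_iff] using h

/-- Colourings of finite boxes of cardinality at most `κ` by natural numbers number at most
`2 ^ κ`. -/
lemma mk_pi_colouring_le {ι : Type} [Finite ι] {α : ι → Type*} {κ : Cardinal} (hκ : ℵ₀ ≤ κ)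
    (hα : ∀ j, #(α j) ≤ κ) : #((∀ j, α j) → ℕ) ≤ 2 ^ κ := by
  have hpi : #(∀ j, α j) ≤ κ := by
    rw [mk_pi]
    refine (prod_le_prod _ (fun _ => κ) hα).trans ?_
    obtain ⟨m, hm⟩ := lt_aleph0.1 (lt_aleph0_of_finite ι)
    simpa [prod_const, hm] using power_nat_le (n := m) hκ
  calc #((∀ j, α j) → ℕ) = ℵ₀ ^ #(∀ j, α j) := by simp
    _ ≤ ℵ₀ ^ κ := power_le_power_left aleph0_ne_zero hpi
    _ = 2 ^ κ := power_eq_two_power hκ (natCast_lt_aleph0 (n := 2)).le hκ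

/-- A polarized partition relation: a colouring of a product by natural numbers is constant on a
box with large sides in the directions of a finite set `s`, the other coordinates being fixed. -/
theorem exists_homogeneous_box {ι : Type} [DecidableEq ι] {Γ : ι → Type*} {β : Cardinal}
    (hβ : ℵ₀ ≤ β) (c : (∀ j, Γ j) → ℕ) (s : Finset ι) (T : ∀ j, Set (Γ j))
    (hT : ∀ j ∈ s, expPlus β s.card ≤ #(T j)) (p : ∀ j, Γ j) :
    ∃ (K : ℕ) (Γ' : ∀ j, Set (Γ j)), (∀ j ∈ s, Γ' j ⊆ T j ∧ β ≤ #(Γ' j)) ∧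
      ∀ a : ∀ j, Γ j, (∀ j ∈ s, a j ∈ Γ' j) → (∀ j ∉ s, a j = p j) → c a = K := by
  induction s using Finset.induction_on generalizing T p with
  | empty =>
    refine ⟨c p, T, by simp, fun a _ ha => ?_⟩
    rw [funext fun j => ha j (by simp)]
  | insert k t hk ih =>
    rw [Finset.card_insert_of_notMem hk] at hT
    set κ := expPlus β t.card
    have hκ : ℵ₀ ≤ κ := hβ.trans (le_expPlus β _)
    have hS : ∀ j, ∃ S : Set (Γ j), j ∈ t → S ⊆ T j ∧ #S = κ := by
      intro j
      by_cases hj : j ∈ t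
      · obtain ⟨S, hS⟩ := le_mk_iff_exists_subset.1
          ((le_expPlus_succ β _).trans (hT j (Finset.mem_insert_of_mem hj)))
        exact ⟨S, fun _ => hS⟩
      · exact ⟨∅, fun h => absurd h hj⟩
    choose S hS using hS
    let e (x : Γ k) (y : ∀ j : t, S j) : ∀ j, Γ j :=
      Function.update (fun j => if hj : j ∈ t then (y ⟨j, hj⟩ : Γ j) else p j) k x
    have hTk : Order.succ (2 ^ κ) ≤ #(T k) :=
      (Order.succ_le_succ (power_le_power_left two_ne_zero (Order.le_succ κ))).trans
        (hT k (Finset.mem_insert_self k t))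
    obtain ⟨d, hd⟩ := exists_large_fiber hκ (T k) hTk (fun x y => c (e x y))
      (mk_pi_colouring_le hκ fun j : t => (hS j j.2).2.le)
    set G : Set (Γ k) := {x | x ∈ T k ∧ (fun y => c (e x y)) = d}
    have hβG : β ≤ #G := (le_expPlus β _).trans
      ((cantor κ).le.trans ((Order.le_succ _).trans hd))
    obtain ⟨x₀, hx₀⟩ : G.Nonempty := by
      rw [← Set.nonempty_coe_sort, ← mk_ne_zero_iff]
      exact ((aleph0_pos.trans_le hβ).trans_le hβG).ne'
    obtain ⟨K, Γ', hΓ', hK⟩ := ih S (fun j hj => (hS j hj).2.ge) (Function.update p k x₀)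
    refine ⟨K, Function.update Γ' k G, fun j hj => ?_, fun a ha hap => ?_⟩
    · rcases eq_or_ne j k with rfl | hjk
      · simpa using ⟨fun x hx => hx.1, hβG⟩
      · have hjt := Finset.mem_of_mem_insert_of_ne hj hjk
        simpa [hjk] using ⟨(hΓ' j hjt).1.trans (hS j hjt).1, (hΓ' j hjt).2⟩
    · have hat : ∀ j ∈ t, a j ∈ Γ' j := fun j hj => by
        have hjk : j ≠ k := fun h => hk (h ▸ hj)
        simpa [hjk] using ha j (Finset.mem_insert_of_mem hj)
      have hak : a k ∈ G := by simpa using ha k (Finset.mem_insert_self k t)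
      let y : ∀ j : t, S j := fun j => ⟨a j, (hΓ' j j.2).1 (hat j j.2)⟩
      have he : ∀ x, e x y = Function.update a k x := by
        intro x
        funext j
        rcases eq_or_ne j k with rfl | hjk
        · simp [e]
        · by_cases hj : j ∈ t
          · simp [e, y, hjk, hj]
          · simp [e, hjk, hj, hap j (by simp [hjk, hj])]
      calc c a = c (e (a k) y) := by rw [he, Function.update_eq_self]
        _ = c (e x₀ y) := congrFun (hak.2.trans hx₀.2.symm) y
        _ = c (Function.update a k x₀) := by rw [he]
        _ = K := by
          refine hK _ (fun j hj => ?_) fun j hj => ?_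
          · have hjk : j ≠ k := fun h => hk (h ▸ hj)
            simpa [hjk] using hat j hj
          · rcases eq_or_ne j k with rfl | hjk
            · simp
            · simpa [hjk] using hap j (by simp [hjk, hj])

theorem reduction_lemma {β : Cardinal} (hβ_unc : ℵ₀ < β) (hβ_reg : β.IsRegular)
    {n : ℕ} (hn : 1 ≤ n) {Γ : Fin n → Type*}
    (f : (∀ j, Γ j) → Fin n)
    (hline : ∀ (j : Fin n) (a : ∀ k, Γ k),
      {b : ∀ k, Γ k | (∀ k, k ≠ j → b k = a k) ∧ f b = j}.Finite)
    (T : ∀ j, Set (Γ j)) (hT : ∀ j, expPlus β n ≤ #(T j)) :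
    ∀ i : Fin n, ∃ (K : ℕ) (Γ' : ∀ j, Set (Γ j)),
      (∀ j, Γ' j ⊆ T j) ∧ (∀ j, β ≤ #(Γ' j)) ∧
      ∀ a : ∀ j, Γ j, (∀ j, j ≠ i → a j ∈ Γ' j) →
        #{x : Γ i // x ∈ Γ' i ∧ f (Function.update a i x) = i} ≤ (K : Cardinal) := by
  intro i
  have hβT : ∀ j, β ≤ #(T j) := fun j => (le_expPlus β n).trans (hT j)
  have hne : ∀ j, Nonempty (T j) := fun j =>
    mk_ne_zero_iff.1 ((aleph0_pos.trans (hβ_unc.trans_le (hβT j))).ne')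
  let p : ∀ j, Γ j := fun j => (hne j).some
  let F (a : ∀ j, Γ j) : Set (Γ i) := {x | f (Function.update a i x) = i}
  have hF : ∀ a, (F a).Finite := fun a =>
    ((hline i a).preimage (Function.update_injective a i).injOn).subset fun x hx =>
      ⟨fun k hk => Function.update_of_ne hk x a, hx⟩
  obtain ⟨K, Γ', hΓ', hK⟩ := exists_homogeneous_box hβ_unc.le (fun a => (F a).ncard)
    (Finset.univ.erase i) T
    (fun j _ => (expPlus_monotone β (by simp)).trans (hT j)) p
  refine ⟨K, Function.update Γ' i (T i), fun j => ?_, fun j => ?_, fun a ha => ?_⟩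
  · rcases eq_or_ne j i with rfl | hj
    · simp
    · simpa [hj] using (hΓ' j (by simp [hj])).1
  · rcases eq_or_ne j i with rfl | hj
    · simpa using hβT j
    · simpa [hj] using (hΓ' j (by simp [hj])).2
  · have hcard : (F a).ncard = K := by
      have h := hK (Function.update a i (p i))
        (fun j hj => by
          have hj : j ≠ i := by simpa using hj
          simpa [hj] using ha j hj)
        (fun j hj => by
          obtain rfl : j = i := by simpa using hj
          simp)
      simpa [F] using h
    calc #{x : Γ i // x ∈ Function.update Γ' i (T i) i ∧ f (Function.update a i x) = i}
        ≤ #(F a) := mk_subtype_le_of_subset fun x hx => hx.2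
      _ = K := by rw [← hcard, Set.cast_ncard (hF a)]
end

section
/- Let λ be the cardinal defined by λ_0 = ℵ₀, λ_{n+1} = 2^{λ_n}, λ = sup_n λ_n. Let X be a real Banach space whose density character is at least λ (i.e. every dense subset of X has cardinality at least λ). If there exist a set Γ and a uniform embedding of X into c₀(Γ), then X contains ℓ_∞^n uniformly: there is a constant C ≥ 1 such that for every n ∈ ℕ there exist vectors v_1, …, v_n ∈ X with max_i |a_i| ≤ ‖Σ_{i=1}^n a_i v_i‖ ≤ C · max_i |a_i| for all scalars a_1, …, a_n ∈ ℝ. -/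
open Cardinal ZeroAtInfty

/-- The sequence `λ₀ = ℵ₀`, `λ_{n+1} = 2 ^ λ_n`. -/
def lamSeq : ℕ → Cardinal
  | 0 => ℵ₀
  | n + 1 => 2 ^ lamSeq n

/-- The cardinal `λ = sup_n λ_n`. -/
noncomputable def lam : Cardinal := ⨆ n, lamSeq n

universe u

open Classical in
/-- A finset colouring of a set larger than the number of colour patterns on `J` is
end-homogeneous along some injective `J`-sequence. -/
theorem exists_endHomogeneous {S C J : Type u} [LinearOrder J] [WellFoundedLT J]
    (c : Finset S → C) (h : #(J × (J → Finset J → C)) < #S) :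
    ∃ (t : J → S) (δ : S), Function.Injective t ∧ ∀ (F : Finset J) (j : J), (∀ i ∈ F, i < j) →
      c (insert (t j) (F.image t)) = c (insert δ (F.image t)) := by
  have hS : Nonempty S := by
    rw [← mk_ne_zero_iff]
    exact (lt_of_le_of_lt zero_le h).ne'
  obtain ⟨s₀⟩ := hS
  let good : (J → S) → S → J → S → Prop := fun T δ j y =>
    (∀ i < j, T i ≠ y) ∧ ∀ F : Finset J, (∀ i ∈ F, i < j) →
      c (insert y (F.image T)) = c (insert δ (F.image T))
  have good_congr : ∀ (T T' : J → S) (δ δ' : S) (j : J), (∀ i < j, T i = T' i) →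
      (∀ F : Finset J, (∀ i ∈ F, i < j) →
        c (insert δ (F.image T)) = c (insert δ' (F.image T'))) →
      good T δ j = good T' δ' j := by
    intro T T' δ δ' j hT hc
    have himg : ∀ F : Finset J, (∀ i ∈ F, i < j) → F.image T = F.image T' := fun F hF =>
      Finset.image_congr fun i hi => hT i (hF i hi)
    funext y
    refine propext (and_congr ?_ ?_)
    · exact forall₂_congr fun i hi => by rw [hT i hi]
    · exact forall₂_congr fun F hF => by rw [hc F hF, himg F hF]
  have ex : ∀ δ : S, ∃ t : J → S, ∀ j, t j = @Classical.epsilon S ⟨s₀⟩ (good t δ j) := by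
    intro δ
    let step : ∀ j : J, (∀ i, i < j → S) → S := fun j r =>
      @Classical.epsilon S ⟨s₀⟩ (good (fun i => if hi : i < j then r i hi else s₀) δ j)
    refine ⟨wellFounded_lt.fix step, fun j => ?_⟩
    rw [WellFounded.fix_eq]
    have hT : ∀ i < j, (if hi : i < j then wellFounded_lt.fix step i else s₀) =
        wellFounded_lt.fix step i := fun i hi => by simp [hi]
    refine congrArg (@Classical.epsilon S ⟨s₀⟩) (good_congr _ _ _ _ _ hT fun F hF => ?_)
    rw [Finset.image_congr fun i hi => hT i (hF i hi)]
  choose t ht using ex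
  have key : ∃ δ, ∀ j, t δ j ≠ δ := by
    by_contra! hcon
    choose j hj using hcon
    let code : S → J × (J → Finset J → C) := fun δ =>
      (j δ, fun k F => if ∀ i ∈ F, i < k then c (insert δ (F.image (t δ))) else c ∅)
    refine not_le_of_gt h (mk_le_of_injective (f := code) fun δ δ' hδ => ?_)
    have h1 : j δ = j δ' := congrArg Prod.fst hδ
    have h2 : ∀ k (F : Finset J), (∀ i ∈ F, i < k) →
        c (insert δ (F.image (t δ))) = c (insert δ' (F.image (t δ'))) := by
      intro k F hF
      have := congrFun (congrFun (congrArg Prod.snd hδ) k) F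
      simpa only [code, if_pos hF] using this
    have h3 : ∀ k, t δ k = t δ' k := by
      intro k
      induction k using WellFoundedLT.induction with
      | ind k ih =>
        rw [ht δ k, ht δ' k]
        exact congrArg _ (good_congr _ _ _ _ _ ih fun F hF => h2 k F hF)
    rw [← hj δ, ← hj δ', ← h1, h3]
  obtain ⟨δ, hδ⟩ := key
  have hgood : ∀ j, good (t δ) δ j (t δ j) := by
    intro j
    have : good (t δ) δ j δ := ⟨fun i _ => hδ i, fun F _ => rfl⟩
    have h1 := @Classical.epsilon_spec_aux S ⟨s₀⟩ (good (t δ) δ j) ⟨δ, this⟩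
    rwa [← ht δ j] at h1
  refine ⟨t δ, δ, fun i k hik => ?_, fun F j hF => (hgood j).2 F hF⟩
  by_contra hne
  rcases lt_or_gt_of_ne hne with hlt | hlt
  · exact (hgood k).1 i hlt hik
  · exact (hgood i).1 k hlt hik.symm

theorem aleph0_le_lamSeq (n : ℕ) : ℵ₀ ≤ lamSeq.{u} n := by
  induction n with
  | zero => exact le_rfl
  | succ n ih => exact ih.trans (cantor _).le

theorem lamSeq_lt_succ (n : ℕ) : lamSeq.{u} n < lamSeq.{u} (n + 1) := cantor _

theorem lamSeq_le_lam (n : ℕ) : lamSeq.{u} n ≤ lam.{u} :=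
  le_ciSup bddAbove_of_small n

theorem lamSeq_monotone : Monotone lamSeq.{u} :=
  monotone_nat_of_le_succ fun n => (lamSeq_lt_succ n).le

open Classical in
/-- A weak form of the Erdős–Rado theorem, with infinite homogeneous sets. -/
theorem exists_infinite_homogeneous {C : Type u} (hC : #C ≤ lamSeq.{u} 2) (r : ℕ) :
    ∀ (S : Type u) (c : Finset S → C), lamSeq.{u} (2 * r + 1) ≤ #S →
      ∃ H : Set S, H.Infinite ∧ ∃ k, ∀ A : Finset S, ↑A ⊆ H → A.card = r → c A = k := by
  induction r with
  | zero =>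
    intro S c hS
    have : Infinite S := infinite_iff.2 ((aleph0_le_lamSeq _).trans hS)
    refine ⟨Set.univ, Set.infinite_univ, c ∅, fun A _ hA => ?_⟩
    rw [Finset.card_eq_zero.1 hA]
  | succ r ih =>
    intro S c hS
    let J : Type u := (lamSeq.{u} (2 * r + 1)).out
    have hJ : #J = lamSeq.{u} (2 * r + 1) := mk_out _
    obtain ⟨_, _⟩ := exists_wellFoundedLT J
    have hJi : Infinite J := infinite_iff.2 ((aleph0_le_lamSeq _).trans hJ.ge)
    have hcard : #(J × (J → Finset J → C)) < #S := by
      refine lt_of_lt_of_le ?_ hS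
      have h1 : #(J → Finset J → C) ≤ lamSeq.{u} (2 * r + 2) := by
        have : #(J → Finset J → C) = (#C ^ #J) ^ #J := by
          simp [mk_finset_of_infinite]
        rw [this, ← power_mul, mul_eq_self (aleph0_le_mk J), hJ]
        calc #C ^ lamSeq.{u} (2 * r + 1) ≤ lamSeq.{u} (2 * r + 2) ^ lamSeq.{u} (2 * r + 1) :=
              power_le_power_right (hC.trans (lamSeq_monotone (by lia)))
          _ = lamSeq.{u} (2 * r + 2) := by
              change (2 ^ lamSeq.{u} (2 * r + 1)) ^ lamSeq.{u} (2 * r + 1) = 2 ^ _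
              rw [← power_mul, mul_eq_self (aleph0_le_lamSeq _)]
      calc #(J × (J → Finset J → C)) = #J * #(J → Finset J → C) := by simp
        _ ≤ lamSeq.{u} (2 * r + 2) * lamSeq.{u} (2 * r + 2) :=
            mul_le_mul' (hJ.le.trans (lamSeq_lt_succ _).le) h1
        _ = lamSeq.{u} (2 * r + 2) := mul_eq_self (aleph0_le_lamSeq _)
        _ < lamSeq.{u} (2 * (r + 1) + 1) := lamSeq_lt_succ _
    obtain ⟨t, δ, ht, hc⟩ := exists_endHomogeneous c hcard
    obtain ⟨H, hH, k, hk⟩ := ih J (fun F => c (insert δ (F.image t))) hJ.ge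
    refine ⟨t '' H, hH.image ht.injOn, k, fun A hA hAr => ?_⟩
    obtain ⟨B, hBH, rfl⟩ := Finset.subset_set_image_iff.1 hA
    rw [Finset.card_image_of_injective _ ht] at hAr
    have hne : B.Nonempty := Finset.card_pos.1 (by lia)
    have hmem := B.max'_mem hne
    have hB := hk (B.erase (B.max' hne))
      (fun x hx => hBH (Finset.mem_of_mem_erase hx)) (by rw [Finset.card_erase_of_mem hmem]; lia)
    have h2 := hc (B.erase (B.max' hne)) (B.max' hne) fun i hi => B.lt_max'_of_mem_erase_max' hne hi
    rw [← Finset.image_insert, Finset.insert_erase hmem] at h2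
    exact h2.trans hB

/-- Every colouring of `r`-tuples in a set of size at least `ℶ_ω` with few colours
admits an injective sequence all of whose increasing `r`-subtuples have the same colour. -/
theorem exists_indiscernible {S : Type u} {K : Type} (hS : lam.{u} ≤ #S)
    (hK : #K ≤ 2 ^ 𝔠) (r : ℕ) (c : (Fin r → S) → K) :
    ∃ e : ℕ → S, Function.Injective e ∧ ∀ w w' : Fin r → ℕ, StrictMono w → StrictMono w' →
      c (e ∘ w) = c (e ∘ w') := by
  classical
  have hC : #(ULift.{u} K) ≤ lamSeq.{u} 2 := by
    rw [mk_uLift]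
    have h1 : lamSeq.{u} 2 = 2 ^ 𝔠 := by
      change 2 ^ (2 ^ ℵ₀) = 2 ^ 𝔠
      rw [two_power_aleph0]
    rw [h1]
    simpa using lift_le.{u}.2 hK
  obtain ⟨_, _⟩ := exists_wellFoundedLT S
  have hSi : Infinite S := infinite_iff.2 ((aleph0_le_lamSeq 0).trans ((lamSeq_le_lam 0).trans hS))
  obtain ⟨H, hH, k, hk⟩ := exists_infinite_homogeneous hC r S
    (fun A => ULift.up <| if h : A.card = r then c (A.orderEmbOfFin h) else
      c fun _ => Classical.arbitrary S) ((lamSeq_le_lam _).trans hS)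
  let e₀ := hH.natEmbedding
  obtain ⟨g, hg | hg⟩ := exists_increasing_or_nonincreasing_subseq (· < ·) fun n => (e₀ n : S)
  · have hmono : StrictMono fun n => (e₀ (g n) : S) := fun m n hmn => hg m n hmn
    refine ⟨fun n => e₀ (g n), hmono.injective, ?_⟩
    have main : ∀ w : Fin r → ℕ, StrictMono w →
        ULift.up (c ((fun n => (e₀ (g n) : S)) ∘ w)) = k := by
      intro w hw
      have hw' := hmono.comp hw
      set A : Finset S := Finset.univ.image ((fun n => (e₀ (g n) : S)) ∘ w) with hA
      have hcard : A.card = r := by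
        rw [hA, Finset.card_image_of_injective _ hw'.injective, Finset.card_univ, Fintype.card_fin]
      have hAH : ↑A ⊆ H := by
        intro x hx
        obtain ⟨i, -, rfl⟩ := Finset.mem_image.1 (Finset.mem_coe.1 hx)
        exact (e₀ _).2
      have := hk A hAH hcard
      rw [dif_pos hcard] at this
      rw [← this, ← Finset.orderEmbOfFin_unique hcard
        (fun i => Finset.mem_image_of_mem _ (Finset.mem_univ i)) hw']
    intro w w' hw hw'
    exact ULift.up_injective ((main w hw).trans (main w' hw').symm)
  · exfalso
    refine (RelEmbedding.natGT (r := ((· < ·) : S → S → Prop)) (fun n => (e₀ (g n) : S))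
      fun n => ?_).not_wellFounded wellFounded_lt
    refine lt_of_le_of_ne (not_lt.1 (hg n (n + 1) n.lt_succ_self)) fun h => ?_
    have := g.injective (e₀.injective (Subtype.ext h))
    lia

/-- The sequence `0, 2, 4, …` with the first `m` entries increased by one. -/
def shiftTuple (r m : ℕ) (p : Fin r) : ℕ := 2 * p + if (p : ℕ) < m then 1 else 0

theorem shiftTuple_strictMono (r m : ℕ) : StrictMono (shiftTuple r m) := by
  intro p q hpq
  have : (p : ℕ) < q := hpq
  unfold shiftTuple
  split_ifs <;> lia

section Supports

variable {Γ : Type*} {n r : ℕ} {G : (Fin n → ℕ) → Γ → ℝ} {σ : (Fin n → ℕ) → ℕ → Γ} {t : ℝ}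

/-- In an indiscernible family, a point of the support that is stable under moving one
coordinate does not depend on the tuple. -/
theorem support_shiftTuple_eq
    (hσ : ∀ A γ, t ≤ |G A γ| → ∃ i, σ A i = γ)
    (hrel : ∀ w w' : Fin r → ℕ, StrictMono w → StrictMono w' → ∀ (P Q : Fin n → Fin r) (i j : ℕ),
      σ (w ∘ P) i = σ (w ∘ Q) j ↔ σ (w' ∘ P) i = σ (w' ∘ Q) j)
    (hval : ∀ w w' : Fin r → ℕ, StrictMono w → StrictMono w' → ∀ (P Q : Fin n → Fin r) (i : ℕ),
      G (w ∘ Q) (σ (w ∘ P) i) = G (w' ∘ Q) (σ (w' ∘ P) i))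
    (hstep : ∀ A A' : Fin n → ℕ, ∀ k, (∀ i, i ≠ k → A i = A' i) → ∀ γ, |G A γ - G A' γ| ≤ t)
    {R R' : Fin n → Fin r} (hR : Function.Injective R) (hRR' : ∀ i k, R i ≠ R' k)
    {w : Fin r → ℕ} (hw : StrictMono w) {i : ℕ} (hi : 2 * t ≤ |G (w ∘ R) (σ (w ∘ R) i)|) (m : ℕ) :
    σ (shiftTuple r m ∘ R) i = σ (shiftTuple r 0 ∘ R) i := by
  induction m with
  | zero => rfl
  | succ m ih =>
    rw [← ih]
    have hne : ∀ p : Fin r, (p : ℕ) ≠ m → shiftTuple r (m + 1) p = shiftTuple r m p := by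
      intro p hp
      unfold shiftTuple
      split_ifs <;> lia
    by_cases hm : ∃ k, (R k : ℕ) = m
    · obtain ⟨k, hk⟩ := hm
      let Q : Fin n → Fin r := Function.update R k (R' k)
      have hv : 2 * t ≤ |G (shiftTuple r m ∘ R) (σ (shiftTuple r m ∘ R) i)| := by
        rwa [hval _ w (shiftTuple_strictMono r m) hw]
      have hd := hstep (shiftTuple r m ∘ R) (shiftTuple r m ∘ Q) k
        (fun j hj => by simp [Q, hj]) (σ (shiftTuple r m ∘ R) i)
      have hq : t ≤ |G (shiftTuple r m ∘ Q) (σ (shiftTuple r m ∘ R) i)| := by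
        have := abs_sub_abs_le_abs_sub (G (shiftTuple r m ∘ R) (σ (shiftTuple r m ∘ R) i))
          (G (shiftTuple r m ∘ Q) (σ (shiftTuple r m ∘ R) i))
        linarith
      obtain ⟨j, hj⟩ := hσ _ _ hq
      have h2 := (hrel _ _ (shiftTuple_strictMono r m) (shiftTuple_strictMono r (m + 1)) R Q i j).1
        hj.symm
      have hQ : shiftTuple r (m + 1) ∘ Q = shiftTuple r m ∘ Q := by
        funext j
        refine hne _ fun hjm => ?_
        by_cases hjk : j = k
        · subst hjk
          refine hRR' j j (Fin.ext ?_)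
          simp only [Q, Function.update_self] at hjm
          rw [hk, hjm]
        · simp only [Q, Function.update_of_ne hjk] at hjm
          exact hjk (hR (Fin.ext (hjm.trans hk.symm)))
      rw [h2, hQ, hj]
    · have : shiftTuple r (m + 1) ∘ R = shiftTuple r m ∘ R :=
        funext fun j => hne _ fun h => hm ⟨j, h⟩
      rw [this]

theorem eval_support_eq (ht : 0 < t)
    (hσ : ∀ A γ, t ≤ |G A γ| → ∃ i, σ A i = γ)
    (hrel : ∀ w w' : Fin r → ℕ, StrictMono w → StrictMono w' → ∀ (P Q : Fin n → Fin r) (i j : ℕ),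
      σ (w ∘ P) i = σ (w ∘ Q) j ↔ σ (w' ∘ P) i = σ (w' ∘ Q) j)
    (hval : ∀ w w' : Fin r → ℕ, StrictMono w → StrictMono w' → ∀ (P Q : Fin n → Fin r) (i : ℕ),
      G (w ∘ Q) (σ (w ∘ P) i) = G (w' ∘ Q) (σ (w' ∘ P) i))
    (hstep : ∀ A A' : Fin n → ℕ, ∀ k, (∀ i, i ≠ k → A i = A' i) → ∀ γ, |G A γ - G A' γ| ≤ t)
    {R R' : Fin n → Fin r} (hR : Function.Injective R) (hRR' : ∀ i k, R i ≠ R' k)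
    {u : Fin r → ℕ} (hu : StrictMono u) {a b : ℕ} (ha : u ∘ R = shiftTuple r a ∘ R)
    (hb : u ∘ R' = shiftTuple r b ∘ R)
    {w : Fin r → ℕ} (hw : StrictMono w) {γ : Γ} (hγ : 2 * t ≤ |G (w ∘ R) γ|) :
    G (w ∘ R) γ = G (w ∘ R') γ := by
  obtain ⟨i, rfl⟩ := hσ _ _ (by linarith : t ≤ |G (w ∘ R) γ|)
  have key := support_shiftTuple_eq hσ hrel hval hstep hR hRR' hw hγ
  rw [hval w u hw hu R R' i, ha, hb, key a, ← key b]
  exact hval _ _ hw (shiftTuple_strictMono _ _) _ _ _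

/-- The position `2 i` in a `2 n`-tuple. -/
def evenPos (i : Fin n) : Fin (2 * n) := ⟨2 * i, by lia⟩

/-- The position `2 i + 1` in a `2 n`-tuple. -/
def oddPos (i : Fin n) : Fin (2 * n) := ⟨2 * i + 1, by lia⟩

theorem val_evenPos (i : Fin n) : (evenPos i : ℕ) = 2 * i := rfl

theorem val_oddPos (i : Fin n) : (oddPos i : ℕ) = 2 * i + 1 := rfl

/-- An indiscernible family of finitely-supported-up-to-`t` functions that moves by at most `t` when
one coordinate is changed moves by at most `4 t` between interlaced tuples. -/
theorem abs_sub_interlaced_le {G : (Fin n → ℕ) → Γ → ℝ} {σ : (Fin n → ℕ) → ℕ → Γ} (ht : 0 < t)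
    (hσ : ∀ A γ, t ≤ |G A γ| → ∃ i, σ A i = γ)
    (hrel : ∀ w w' : Fin (2 * n) → ℕ, StrictMono w → StrictMono w' →
      ∀ (P Q : Fin n → Fin (2 * n)) (i j : ℕ),
      σ (w ∘ P) i = σ (w ∘ Q) j ↔ σ (w' ∘ P) i = σ (w' ∘ Q) j)
    (hval : ∀ w w' : Fin (2 * n) → ℕ, StrictMono w → StrictMono w' →
      ∀ (P Q : Fin n → Fin (2 * n)) (i : ℕ),
      G (w ∘ Q) (σ (w ∘ P) i) = G (w' ∘ Q) (σ (w' ∘ P) i))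
    (hstep : ∀ A A' : Fin n → ℕ, ∀ k, (∀ i, i ≠ k → A i = A' i) → ∀ γ, |G A γ - G A' γ| ≤ t)
    {w : Fin (2 * n) → ℕ} (hw : StrictMono w) (γ : Γ) :
    |G (w ∘ evenPos) γ - G (w ∘ oddPos) γ| ≤ 4 * t := by
  have hev : Function.Injective (evenPos (n := n)) := fun i j h => by
    have := congrArg Fin.val h
    simp only [evenPos] at this
    exact Fin.ext (by lia)
  have hod : Function.Injective (oddPos (n := n)) := fun i j h => by
    have := congrArg Fin.val h
    simp only [oddPos] at this
    exact Fin.ext (by lia)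
  have hne : ∀ i k : Fin n, evenPos i ≠ oddPos k := fun i k h => by
    have := congrArg Fin.val h
    simp only [evenPos, oddPos] at this
    lia
  by_contra! hcon
  have hsub : |G (w ∘ evenPos) γ - G (w ∘ oddPos) γ| ≠ 0 := by linarith
  have hor : 2 * t ≤ |G (w ∘ evenPos) γ| ∨ 2 * t ≤ |G (w ∘ oddPos) γ| := by
    by_contra! h
    have := abs_sub (G (w ∘ evenPos) γ) (G (w ∘ oddPos) γ)
    linarith [h.1, h.2]
  have hu : ∀ d, StrictMono fun p : Fin (2 * n) => 2 * ((p : ℕ) - p % 2) + p % 2 + d := by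
    intro d p q hpq
    have : (p : ℕ) < q := hpq
    dsimp only
    lia
  rcases hor with h | h
  · refine hsub ?_
    rw [eval_support_eq ht hσ hrel hval hstep hev hne (hu 0) (a := 0) (b := 2 * n) ?_ ?_ hw h,
      sub_self, abs_zero]
    · funext i
      simp only [Function.comp, shiftTuple, val_evenPos]
      split_ifs <;> lia
    · funext i
      have := i.2
      simp only [Function.comp, shiftTuple, val_evenPos, val_oddPos]
      split_ifs <;> lia
  · refine hsub ?_
    rw [eval_support_eq ht hσ hrel hval hstep hod (fun i k => (hne k i).symm) (hu 2) (a := 2 * n)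
      (b := 0) ?_ ?_ hw h, sub_self, abs_zero]
    · funext i
      have := i.2
      simp only [Function.comp, shiftTuple, val_oddPos]
      split_ifs <;> lia
    · funext i
      simp only [Function.comp, shiftTuple, val_evenPos, val_oddPos]
      split_ifs <;> lia

end Supports

section Unconditional

variable {X : Type*} [NormedAddCommGroup X] [NormedSpace ℝ X] {n : ℕ} {y : ℕ → X}

theorem norm_sum_update_zero_le (hy : ∀ k, ‖y k‖ ≤ 1)
    (hN : ∀ w w' : Fin (2 * n) → ℕ, StrictMono w → StrictMono w' → ∀ a : Fin n → ℝ,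
      ‖∑ i, a i • (y (w (evenPos i)) - y (w (oddPos i)))‖ =
        ‖∑ i, a i • (y (w' (evenPos i)) - y (w' (oddPos i)))‖)
    (a : Fin n → ℝ) (k : Fin n) {w : Fin (2 * n) → ℕ} (hw : StrictMono w) :
    ‖∑ i, Function.update a k 0 i • (y (w (evenPos i)) - y (w (oddPos i)))‖ ≤
      ‖∑ i, a i • (y (w (evenPos i)) - y (w (oddPos i)))‖ := by
  set N₀ := ‖∑ i, Function.update a k 0 i • (y (w (evenPos i)) - y (w (oddPos i)))‖ with hN₀
  set N₁ := ‖∑ i, a i • (y (w (evenPos i)) - y (w (oddPos i)))‖ with hN₁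
  have key : ∀ M : ℕ, (M : ℝ) * (N₀ - N₁) ≤ 2 * |a k| := by
    intro M
    rcases Nat.eq_zero_or_pos M with rfl | hM
    · simp
    let W : ℕ → Fin (2 * n) → ℕ := fun j p =>
      p + if (p : ℕ) < 2 * k then 0 else if (p : ℕ) ≤ 2 * k + 1 then j else M
    have hW : ∀ j < M, StrictMono (W j) := by
      intro j hj p q hpq
      have : (p : ℕ) < q := hpq
      simp only [W]
      split_ifs <;> lia
    set V := ∑ i, Function.update a k 0 i • (y (W 0 (evenPos i)) - y (W 0 (oddPos i))) with hV
    have hVN : ‖V‖ = N₀ := hN _ _ (hW 0 hM) hw _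
    have hsum : ∀ j < M, ∑ i, a i • (y (W j (evenPos i)) - y (W j (oddPos i))) =
        V + a k • (y (2 * k + j) - y (2 * k + (j + 1))) := by
      intro j hj
      rw [hV, ← Finset.add_sum_erase _ _ (Finset.mem_univ k),
        ← Finset.add_sum_erase (a := k) Finset.univ
          (fun i => Function.update a k 0 i • (y (W 0 (evenPos i)) - y (W 0 (oddPos i))))
          (Finset.mem_univ k)]
      have h1 : W j (evenPos k) = 2 * k + j := by simp [W, evenPos]
      have h2 : W j (oddPos k) = 2 * k + (j + 1) := by simp [W, oddPos]; lia
      rw [h1, h2, Function.update_self, zero_smul, zero_add, add_comm]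
      congr 1
      refine Finset.sum_congr rfl fun i hi => ?_
      have hik : i ≠ k := Finset.ne_of_mem_erase hi
      have hik' : (i : ℕ) ≠ k := fun h => hik (Fin.ext h)
      rw [Function.update_of_ne hik]
      have h3 : W j (evenPos i) = W 0 (evenPos i) := by
        simp only [W, evenPos]
        split_ifs <;> lia
      have h4 : W j (oddPos i) = W 0 (oddPos i) := by
        simp only [W, oddPos]
        split_ifs <;> lia
      rw [h3, h4]
    have htot : ‖∑ j ∈ Finset.range M, (V + a k • (y (2 * k + j) - y (2 * k + (j + 1))))‖ ≤
        M * N₁ := by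
      refine (norm_sum_le _ _).trans ?_
      rw [Finset.sum_congr rfl (g := fun _ => N₁), Finset.sum_const, Finset.card_range, nsmul_eq_mul]
      intro j hj
      rw [← hsum j (Finset.mem_range.1 hj)]
      exact hN _ _ (hW j (Finset.mem_range.1 hj)) hw _
    rw [Finset.sum_add_distrib, ← Finset.smul_sum,
      Finset.sum_range_sub' (fun j => y (2 * (k : ℕ) + j)), Finset.sum_const,
      Finset.card_range] at htot
    have h5 : ‖M • V‖ = M * N₀ := by
      rw [← Nat.cast_smul_eq_nsmul ℝ, norm_smul, hVN, Real.norm_natCast]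
    have h6 : ‖a k • (y (2 * (k : ℕ) + 0) - y (2 * (k : ℕ) + M))‖ ≤ |a k| * 2 := by
      rw [norm_smul, Real.norm_eq_abs]
      refine mul_le_mul_of_nonneg_left ?_ (abs_nonneg _)
      refine (norm_sub_le _ _).trans ?_
      linarith [hy (2 * (k : ℕ) + 0), hy (2 * (k : ℕ) + M)]
    have h7 := norm_le_add_norm_add (M • V) (a k • (y (2 * (k : ℕ) + 0) - y (2 * (k : ℕ) + M)))
    rw [h5] at h7
    linarith
  by_contra! hlt
  obtain ⟨M, hM⟩ := exists_nat_gt (2 * |a k| / (N₀ - N₁))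
  rw [div_lt_iff₀ (by linarith)] at hM
  linarith [key M]

/-- A seminorm on `ℝⁿ` that does not increase when a coordinate is dropped does not increase under
multipliers with values in `[0, 1]`. -/
theorem seminorm_mul_le (N : Seminorm ℝ (Fin n → ℝ))
    (h0 : ∀ a k, N (Function.update a k 0) ≤ N a)
    (a b : Fin n → ℝ) (hb0 : ∀ i, 0 ≤ b i) (hb1 : ∀ i, b i ≤ 1) :
    N (fun i => b i * a i) ≤ N a := by
  have h1 : ∀ (a : Fin n → ℝ) k θ, 0 ≤ θ → θ ≤ 1 → N (Function.update a k (θ * a k)) ≤ N a := by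
    intro a k θ hθ hθ'
    have : Function.update a k (θ * a k) = θ • a + (1 - θ) • Function.update a k 0 := by
      funext i
      by_cases hi : i = k
      · subst hi; simp
      · simp [hi]; ring
    rw [this]
    refine (map_add_le_add N _ _).trans ?_
    rw [map_smul_eq_mul, map_smul_eq_mul, Real.norm_of_nonneg hθ, Real.norm_of_nonneg (by linarith)]
    nlinarith [h0 a k]
  have h2 : ∀ T : Finset (Fin n), N (fun i => if i ∈ T then b i * a i else a i) ≤ N a := by
    intro T
    induction T using Finset.induction_on with
    | empty => simp
    | insert k T hk ih =>
      refine le_trans (le_of_eq ?_) ((h1 _ k (b k) (hb0 k) (hb1 k)).trans ih)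
      congr 1
      funext i
      by_cases hi : i = k
      · subst hi; simp [hk]
      · simp [hi]
  simpa using h2 Finset.univ

theorem seminorm_le_of_le (N : Seminorm ℝ (Fin n → ℝ))
    (h0 : ∀ a k, N (Function.update a k 0) ≤ N a)
    {a b : Fin n → ℝ} (ha : ∀ i, 0 ≤ a i) (hab : ∀ i, a i ≤ b i) : N a ≤ N b := by
  have h := seminorm_mul_le N h0 b (fun i => a i / b i)
    (fun i => div_nonneg (ha i) ((ha i).trans (hab i)))
    (fun i => div_le_one_of_le₀ (hab i) ((ha i).trans (hab i)))
  refine le_trans (le_of_eq (congrArg N (funext fun i => ?_))) h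
  by_cases hb : b i = 0
  · have : a i = 0 := le_antisymm (hb ▸ hab i) (ha i)
    simp [hb, this]
  · field_simp

/-- Vectors whose coordinate projections are contractive and whose sum is bounded are equivalent to
the unit vector basis of `ℓ_∞ⁿ`. -/
theorem norm_sum_smul_bounds {z : Fin n → X} {K : ℝ}
    (h0 : ∀ (a : Fin n → ℝ) k, ‖∑ i, Function.update a k 0 i • z i‖ ≤ ‖∑ i, a i • z i‖)
    (hz : ∀ i, 1 ≤ ‖z i‖) (hK : ‖∑ i, z i‖ ≤ K) (a : Fin n → ℝ) :
    (∀ i, |a i| ≤ ‖∑ j, a j • z j‖) ∧ ‖∑ j, a j • z j‖ ≤ 2 * K * ⨆ i, |a i| := by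
  let N : Seminorm ℝ (Fin n → ℝ) :=
    (normSeminorm ℝ X).comp (∑ i, (LinearMap.proj i : (Fin n → ℝ) →ₗ[ℝ] ℝ).smulRight (z i))
  have hNa : ∀ a, N a = ‖∑ i, a i • z i‖ := fun a => by simp [N]
  have hN0 : ∀ a k, N (Function.update a k 0) ≤ N a := fun a k => by
    rw [hNa, hNa]; exact h0 a k
  rw [← hNa]
  constructor
  · intro i
    have h := seminorm_mul_le N hN0 a (fun j => if j = i then 1 else 0)
      (fun j => by split_ifs <;> norm_num) (fun j => by split_ifs <;> norm_num)
    refine le_trans ?_ h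
    rw [hNa]
    simp only [ite_mul, one_mul, zero_mul, ite_smul, zero_smul, Finset.sum_ite_eq',
      Finset.mem_univ, if_true, norm_smul, Real.norm_eq_abs]
    exact le_mul_of_one_le_right (abs_nonneg _) (hz i)
  · set m := ⨆ i, |a i| with hm
    have ham : ∀ i, |a i| ≤ m := fun i => le_ciSup (Set.finite_range fun i => |a i|).bddAbove i
    have hm0 : 0 ≤ m := Real.iSup_nonneg fun i => abs_nonneg _
    have hNm : N (fun _ => m) ≤ m * K := by
      rw [hNa, ← Finset.smul_sum, norm_smul, Real.norm_of_nonneg hm0]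
      exact mul_le_mul_of_nonneg_left hK hm0
    have hp : N (fun i => max (a i) 0) ≤ m * K :=
      (seminorm_le_of_le N hN0 (fun i => le_max_right _ _)
        fun i => max_le ((le_abs_self _).trans (ham i)) hm0).trans hNm
    have hq : N (fun i => max (-a i) 0) ≤ m * K :=
      (seminorm_le_of_le N hN0 (fun i => le_max_right _ _)
        fun i => max_le ((neg_le_abs _).trans (ham i)) hm0).trans hNm
    have hsplit : a = (fun i => max (a i) 0) - fun i => max (-a i) 0 := by
      funext i
      rcases le_total 0 (a i) with h | h <;> simp [h]
    calc N a ≤ N (fun i => max (a i) 0) + N (fun i => max (-a i) 0) := by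
          conv_lhs => rw [hsplit]
          exact map_sub_le_add N _ _
      _ ≤ 2 * K * m := by linarith

end Unconditional

section Density

variable {X : Type u} [NormedAddCommGroup X] [NormedSpace ℝ X]

/-- A subset of the unit ball that is `1/2`-dense in it spans a dense rational subspace. -/
theorem dense_range_list_sum {D : Set X} (hD : ∀ x : X, ‖x‖ ≤ 1 → ∃ d ∈ D, ‖x - d‖ ≤ 1 / 2) :
    Dense (Set.range fun l : List (D × ℚ) => (l.map fun p => (p.2 : ℝ) • (p.1 : X)).sum) := by
  have key : ∀ (x : X) (q : ℚ), 0 < q → ‖x‖ ≤ q → ∀ k : ℕ, ∃ l : List (D × ℚ),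
      ‖x - (l.map fun p => (p.2 : ℝ) • (p.1 : X)).sum‖ ≤ q / 2 ^ k := by
    intro x q hq hx k
    induction k with
    | zero => exact ⟨[], by simpa using hx⟩
    | succ k ih =>
      obtain ⟨l, hl⟩ := ih
      set r := x - (l.map fun p => (p.2 : ℝ) • (p.1 : X)).sum with hr
      have hc : (0 : ℝ) < q / 2 ^ k := by positivity
      obtain ⟨d, hd, hrd⟩ := hD ((q / 2 ^ k : ℝ)⁻¹ • r) (by
        rw [norm_smul, norm_inv, Real.norm_of_nonneg hc.le]
        exact inv_mul_le_one_of_le₀ hl hc.le)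
      refine ⟨(⟨d, hd⟩, q / 2 ^ k) :: l, ?_⟩
      have h1 : x - (((⟨d, hd⟩, q / 2 ^ k) :: l : List (D × ℚ)).map
          fun p => (p.2 : ℝ) • (p.1 : X)).sum =
          (q / 2 ^ k : ℝ) • ((q / 2 ^ k : ℝ)⁻¹ • r - d) := by
        rw [smul_sub, smul_inv_smul₀ hc.ne', hr]
        simp only [List.map_cons, List.sum_cons]
        push_cast
        abel
      rw [h1, norm_smul, Real.norm_of_nonneg hc.le, pow_succ]
      calc (q / 2 ^ k : ℝ) * ‖(q / 2 ^ k : ℝ)⁻¹ • r - d‖ ≤ q / 2 ^ k * (1 / 2) :=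
            mul_le_mul_of_nonneg_left hrd hc.le
        _ = q / (2 ^ k * 2) := by field_simp
  intro x
  rw [Metric.mem_closure_iff]
  intro ε hε
  obtain ⟨q, hq⟩ := exists_rat_gt ‖x‖
  have hq0 : (0 : ℝ) < q := (norm_nonneg x).trans_lt hq
  obtain ⟨k, hk⟩ := exists_pow_lt_of_lt_one (div_pos hε hq0) (by norm_num : (1 / 2 : ℝ) < 1)
  obtain ⟨l, hl⟩ := key x q (by exact_mod_cast hq0) hq.le k
  refine ⟨_, ⟨l, rfl⟩, ?_⟩
  rw [dist_eq_norm]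
  refine hl.trans_lt ?_
  rw [lt_div_iff₀ hq0, one_div, inv_pow] at hk
  rw [div_eq_inv_mul]
  exact hk

theorem exists_separated_of_density (hdens : ∀ D : Set X, Dense D → lam.{u} ≤ #D) :
    ∃ D : Set X, (∀ x ∈ D, ‖x‖ ≤ 1) ∧ D.Pairwise (fun x y => 1 / 2 ≤ ‖x - y‖) ∧
      lam.{u} ≤ #D := by
  obtain ⟨D, hD⟩ := zorn_subset
    {D : Set X | (∀ x ∈ D, ‖x‖ ≤ 1) ∧ D.Pairwise fun x y => 1 / 2 ≤ ‖x - y‖} (by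
      intro c hc hchain
      refine ⟨⋃₀ c, ⟨?_, ?_⟩, fun s hs => Set.subset_sUnion_of_mem hs⟩
      · rintro x ⟨s, hs, hx⟩
        exact (hc hs).1 x hx
      · exact (Set.pairwise_sUnion hchain.directedOn).2 fun s hs => (hc hs).2)
  refine ⟨D, hD.prop.1, hD.prop.2, ?_⟩
  have hcov : ∀ x : X, ‖x‖ ≤ 1 → ∃ d ∈ D, ‖x - d‖ ≤ 1 / 2 := by
    intro x hx
    by_contra! hcon
    have hxD : x ∈ D := by
      refine hD.le_of_ge (y := insert x D) ⟨?_, ?_⟩ (Set.subset_insert x D) (Set.mem_insert x D)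
      · rintro y (rfl | hy)
        exacts [hx, hD.prop.1 y hy]
      · refine hD.prop.2.insert fun y hy _ => ⟨(hcon y hy).le, ?_⟩
        rw [norm_sub_rev]
        exact (hcon y hy).le
    have := hcon x hxD
    norm_num at this
  have hle := (hdens _ (dense_range_list_sum hcov)).trans (mk_range_le.trans (mk_list_le_max _))
  have hlt : ∀ n, lamSeq.{u} n < lam.{u} := fun n =>
    (lamSeq_lt_succ n).trans_le (lamSeq_le_lam _)
  have h1 : ℵ₀ < lam.{u} := hlt 0
  have h2 : lam.{u} ≤ #(D × ℚ) := by
    rcases le_max_iff.1 hle with h | h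
    · exact absurd h1 h.not_gt
    · exact h
  have h3 : #(D × ℚ) = #D * ℵ₀ := by simp
  rw [h3] at h2
  rcases le_max_iff.1 (h2.trans (mul_le_max_of_aleph0_le_right le_rfl)) with h | h
  · exact h
  · exact absurd h1 h.not_gt

end Density

theorem mk_fun_le_two_power_continuum {A B : Type} (hA : #A ≤ 𝔠) (hB : #B ≤ 𝔠) :
    #(A → B) ≤ 2 ^ 𝔠 := by
  have h : (2 : Cardinal) ^ 𝔠 = 𝔠 ^ 𝔠 := by
    rw [← two_power_aleph0, ← power_mul, two_power_aleph0, aleph0_mul_continuum]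
  rw [← power_def, h]
  exact (power_le_power_right hB).trans (power_le_power_left continuum_ne_zero hA)

theorem ZeroAtInftyContinuousMap.exists_enumeration {Γ : Type*} [TopologicalSpace Γ]
    [DiscreteTopology Γ] [Nonempty Γ] (h : C₀(Γ, ℝ)) {t : ℝ} (ht : 0 < t) :
    ∃ σ : ℕ → Γ, ∀ γ, t ≤ |h γ| → ∃ i, σ i = γ := by
  have hfin : {γ | t ≤ |h γ|}.Finite := by
    have h1 := h.zero_at_infty'
    rw [Filter.cocompact_eq_cofinite, Metric.tendsto_nhds] at h1
    have h2 := Filter.eventually_cofinite.1 (h1 t ht)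
    refine h2.subset fun γ hγ => ?_
    simpa using hγ
  obtain ⟨σ, hσ⟩ := (hfin.countable.insert (Classical.arbitrary Γ)).exists_eq_range
    (Set.insert_nonempty _ _)
  refine ⟨σ, fun γ hγ => ?_⟩
  have : γ ∈ Set.range σ := hσ ▸ Set.mem_insert_of_mem _ hγ
  exact this

section Colour

variable {X : Type u} [NormedAddCommGroup X] [NormedSpace ℝ X] {Γ : Type*} [TopologicalSpace Γ]
  [DiscreteTopology Γ]

/-- In a large bounded set there are indiscernible sequences whose interlaced sums have close images
under a map into `c₀(Γ)` that is nearly constant on small balls. -/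
theorem exists_interlaced_close [Nonempty Γ] {D : Set X} (hD : lam.{u} ≤ #D)
    (hD1 : ∀ x ∈ D, ‖x‖ ≤ 1) (f : X → C₀(Γ, ℝ)) {s t : ℝ} (ht : 0 < t)
    (hf : ∀ x y, ‖x - y‖ ≤ 2 * |s| → ‖f x - f y‖ ≤ t) (n : ℕ) :
    ∃ e : ℕ → D, Function.Injective e ∧
      (∀ w w' : Fin (2 * n) → ℕ, StrictMono w → StrictMono w' → ∀ a : Fin n → ℝ,
        ‖∑ i, a i • ((e (w (evenPos i)) : X) - e (w (oddPos i)))‖ =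
          ‖∑ i, a i • ((e (w' (evenPos i)) : X) - e (w' (oddPos i)))‖) ∧
      ∀ w : Fin (2 * n) → ℕ, StrictMono w →
        ‖f (s • ∑ i, (e (w (evenPos i)) : X)) - f (s • ∑ i, (e (w (oddPos i)) : X))‖ ≤ 4 * t := by
  let g : (Fin n → D) → C₀(Γ, ℝ) := fun A => f (s • ∑ i, (A i : X))
  choose σ hσ using fun A => (g A).exists_enumeration ht
  let I := Fin n → Fin (2 * n)
  let K : Type := ((Fin n → ℝ) → ℝ) × (I × I × ℕ × ℕ → Prop) × (I × I × ℕ → ℝ)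
  have hK : #K ≤ 2 ^ 𝔠 := by
    have hω : ℵ₀ ≤ (2 : Cardinal) ^ 𝔠 := aleph0_le_continuum.trans (cantor _).le
    have h1 : #((Fin n → ℝ) → ℝ) ≤ 2 ^ 𝔠 := by
      refine mk_fun_le_two_power_continuum ?_ mk_real.le
      rw [← power_def, mk_real, mk_fin]
      exact_mod_cast power_nat_le aleph0_le_continuum
    have h2 : #(I × I × ℕ × ℕ → Prop) ≤ 2 ^ 𝔠 :=
      mk_fun_le_two_power_continuum (mk_le_aleph0.trans aleph0_le_continuum)
        (mk_le_aleph0.trans aleph0_le_continuum)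
    have h3 : #(I × I × ℕ → ℝ) ≤ 2 ^ 𝔠 :=
      mk_fun_le_two_power_continuum (mk_le_aleph0.trans aleph0_le_continuum) mk_real.le
    simp only [K, mk_prod, lift_id]
    exact mul_le_of_le hω h1 (mul_le_of_le hω h2 h3)
  obtain ⟨e, he, hc⟩ := exists_indiscernible (K := K) hD hK (2 * n) fun u =>
    (fun a => ‖∑ i, a i • ((u (evenPos i) : X) - u (oddPos i))‖,
      fun q => σ (u ∘ q.1) q.2.2.1 = σ (u ∘ q.2.1) q.2.2.2,
      fun q => g (u ∘ q.2.1) (σ (u ∘ q.1) q.2.2))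
  refine ⟨e, he, fun w w' hw hw' a => ?_, fun w hw => ?_⟩
  · exact congrFun (congrArg Prod.fst (hc w w' hw hw')) a
  · have hstep : ∀ A A' : Fin n → ℕ, ∀ k, (∀ i, i ≠ k → A i = A' i) →
        ∀ γ, |g (e ∘ A) γ - g (e ∘ A') γ| ≤ t := by
      intro A A' k hAA' γ
      have h1 : ‖g (e ∘ A) - g (e ∘ A')‖ ≤ t := by
        refine hf _ _ ?_
        rw [← smul_sub, ← Finset.sum_sub_distrib, Finset.sum_eq_single k, norm_smul,
          Real.norm_eq_abs, mul_comm]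
        · refine mul_le_mul_of_nonneg_right ?_ (abs_nonneg _)
          refine (norm_sub_le _ _).trans ?_
          linarith [hD1 _ (e (A k)).2, hD1 _ (e (A' k)).2, show ‖((e ∘ A) k : X)‖ =
            ‖(e (A k) : X)‖ from rfl, show ‖((e ∘ A') k : X)‖ = ‖(e (A' k) : X)‖ from rfl]
        · intro i _ hi
          simp [hAA' i hi]
        · simp
      refine le_trans ?_ h1
      exact (g (e ∘ A) - g (e ∘ A')).toBCF.norm_coe_le_norm γ
    change ‖(g (e ∘ w ∘ evenPos) - g (e ∘ w ∘ oddPos)).toBCF‖ ≤ 4 * t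
    refine (BoundedContinuousFunction.norm_le (by linarith)).2 fun γ => ?_
    exact abs_sub_interlaced_le (G := fun A => g (e ∘ A)) (σ := fun A => σ (e ∘ A)) ht
      (fun A => hσ (e ∘ A))
      (fun w w' hw hw' P Q i j => iff_of_eq <|
        congrFun (congrArg (fun z => z.2.1) (hc w w' hw hw')) (P, Q, i, j))
      (fun w w' hw hw' P Q i =>
        congrFun (congrArg (fun z => z.2.2) (hc w w' hw hw')) (P, Q, i))
      hstep hw γ

end Colour

theorem theoremA {X : Type*} [NormedAddCommGroup X] [NormedSpace ℝ X]
    [CompleteSpace X]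
    (hdens : ∀ D : Set X, Dense D → lam ≤ #D)
    {Γ : Type*} [TopologicalSpace Γ] [DiscreteTopology Γ]
    (f : X → C₀(Γ, ℝ)) (hf : IsUniformEmbedding f) :
    ∃ C : ℝ, 1 ≤ C ∧ ∀ n : ℕ, ∃ v : Fin n → X, ∀ a : Fin n → ℝ,
      (∀ i, |a i| ≤ ‖∑ j, a j • v j‖) ∧
      ‖∑ j, a j • v j‖ ≤ C * ⨆ i, |a i| := by
  obtain ⟨D, hD1, hDsep, hD⟩ := exists_separated_of_density hdens
  have hDinf : Infinite D :=
    infinite_iff.2 ((aleph0_le_lamSeq 0).trans ((lamSeq_le_lam 0).trans hD))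
  have hΓ : Nonempty Γ := by
    by_contra hΓ
    rw [not_nonempty_iff] at hΓ
    obtain ⟨x, y, hxy⟩ := exists_pair_ne D
    exact hxy (Subtype.ext (hf.injective (DFunLike.ext _ _ fun γ => hΓ.elim γ)))
  obtain ⟨-, huc, hinv⟩ := Metric.isUniformEmbedding_iff.1 hf
  obtain ⟨δ, hδ, hfδ⟩ := hinv 1 one_pos
  obtain ⟨η, hη, hfη⟩ := Metric.uniformContinuous_iff.1 huc (δ / 8) (by positivity)
  have hs : 0 < η / 4 := by positivity
  refine ⟨max 1 (2 * (2 * (4 / η))), le_max_left _ _, fun n => ?_⟩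
  obtain ⟨e, he, hN, hclose⟩ := exists_interlaced_close hD hD1 f (s := η / 4) (t := δ / 8)
    (by positivity) (fun x y hxy => by
      rw [← dist_eq_norm]
      refine (hfη ?_).le
      rw [dist_eq_norm]
      rw [abs_of_pos hs] at hxy
      linarith) n
  have hw : StrictMono fun p : Fin (2 * n) => (p : ℕ) := fun p q h => h
  let z : Fin n → X := fun i =>
    (2 : ℝ) • ((e (evenPos i : Fin (2 * n)) : X) - e (oddPos i : Fin (2 * n)))
  have hsmul : ∀ a : Fin n → ℝ, ∑ i, a i • z i =
      (2 : ℝ) • ∑ i, a i • ((e (evenPos i : Fin (2 * n)) : X) - e (oddPos i : Fin (2 * n))) := by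
    intro a
    rw [Finset.smul_sum]
    exact Finset.sum_congr rfl fun i _ => smul_comm _ _ _
  have h0 : ∀ (a : Fin n → ℝ) k, ‖∑ i, Function.update a k 0 i • z i‖ ≤ ‖∑ i, a i • z i‖ := by
    intro a k
    rw [hsmul, hsmul, norm_smul, norm_smul]
    exact mul_le_mul_of_nonneg_left
      (norm_sum_update_zero_le (fun k => hD1 _ (e k).2) hN a k hw) (norm_nonneg _)
  have hz : ∀ i, 1 ≤ ‖z i‖ := by
    intro i
    have hne : (e (evenPos i : Fin (2 * n)) : X) ≠ e (oddPos i : Fin (2 * n)) := fun h => by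
      have := he (Subtype.ext h)
      rw [val_evenPos, val_oddPos] at this
      lia
    have := hDsep (e _).2 (e _).2 hne
    rw [norm_smul, Real.norm_of_nonneg (by norm_num)]
    linarith
  have hK : ‖∑ i, z i‖ ≤ 2 * (4 / η) := by
    have h1 : dist (f ((η / 4) • ∑ i, (e (evenPos i : Fin (2 * n)) : X)))
        (f ((η / 4) • ∑ i, (e (oddPos i : Fin (2 * n)) : X))) < δ := by
      rw [dist_eq_norm]
      have := hclose _ hw
      linarith
    have h2 := hfδ h1
    rw [dist_eq_norm, ← smul_sub, norm_smul, Real.norm_of_nonneg hs.le,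
      ← Finset.sum_sub_distrib] at h2
    rw [← Finset.smul_sum, norm_smul, Real.norm_of_nonneg (by norm_num)]
    refine mul_le_mul_of_nonneg_left ?_ (by norm_num)
    rw [le_div_iff₀ hη]
    linarith
  refine ⟨z, fun a => ?_⟩
  obtain ⟨hlow, hup⟩ := norm_sum_smul_bounds h0 hz hK a
  exact ⟨hlow, hup.trans (mul_le_mul_of_nonneg_right (le_max_right _ _)
    (Real.iSup_nonneg fun i => abs_nonneg _))⟩
end
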